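/- arXiv:funct-an/9712007 — 2 statements merged into one kernel-verified Lean document; each statement's English description precedes it below -/
import Mathlib

section
/- Let Ω_CK := {ω ⊆ 𝔽_n : ω satisfies (S1)–(S4)}, regarded as a subspace of the product space {0,1}^{𝔽_n}. The map ω ↦ ω ∩ 𝔽_n^+ is a bijection from Ω_CK onto the collection {Pref(μ) : μ ∈ P_A^∞}, where Pref(μ) := {e} ∪ {μ_1μ_2⋯μ_k : k ≥ 1} ⊆ 𝔽_n^+ is the set of finite initial segments of μ viewed as elements of 𝔽_n. Moreover, the induced map Ω_CK → P_A^∞ sending ω to the unique μ with ω ∩ 𝔽_n^+ = Pref(μ) is a homeomorphism. -/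
/-- The positive word `g_{i_1} ⋯ g_{i_k} ∈ 𝔽_n` associated to a list of letters. -/
def wordToF {n : ℕ} (l : List (Fin n)) : FreeGroup (Fin n) :=
  (l.map FreeGroup.of).prod

/-- Conditions (S1)–(S4) on a subset `ω ⊆ 𝔽_n`. -/
def SCond {n : ℕ} (a : Fin n → Fin n → Bool) (ω : Set (FreeGroup (Fin n))) : Prop :=
  (1 : FreeGroup (Fin n)) ∈ ω ∧
  (∀ t r : FreeGroup (Fin n), t * r ∈ ω →
    FreeGroup.norm (t * r) = FreeGroup.norm t + FreeGroup.norm r → t ∈ ω) ∧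
  (∀ t ∈ ω, ∃! j : Fin n, t * FreeGroup.of j ∈ ω) ∧
  (∀ t ∈ ω, ∀ i j : Fin n, t * FreeGroup.of j ∈ ω →
    (t * (FreeGroup.of i)⁻¹ ∈ ω ↔ a i j = true))

/-- `Ω_CK`, realized inside the product space `{0,1}^{𝔽_n}`: the `Bool`-valued
characteristic functions of subsets of `𝔽_n` satisfying (S1)–(S4). -/
abbrev OmegaCK {n : ℕ} (a : Fin n → Fin n → Bool) : Type _ :=
  {ω : FreeGroup (Fin n) → Bool // SCond a {x | ω x = true}}

/-- Infinite path space `P_A^∞`: sequences `μ` with `a (μ j) (μ (j+1)) = 1` for all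
`j`, a (compact) subspace of the product space `{1,…,n}^ℕ`. -/
abbrev PathSpace {n : ℕ} (a : Fin n → Fin n → Bool) : Type _ :=
  {μ : ℕ → Fin n // ∀ j : ℕ, a (μ j) (μ (j + 1)) = true}

/-- The group element `μ_1 μ_2 ⋯ μ_k ∈ 𝔽_n` (`k = 0` gives the identity). -/
def prefWord {n : ℕ} (μ : ℕ → Fin n) (k : ℕ) : FreeGroup (Fin n) :=
  wordToF ((List.range k).map μ)

/-- `Pref μ = {e} ∪ {μ_1⋯μ_k : k ≥ 1}`, the finite initial segments of `μ` viewed as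
elements of `𝔽_n`. -/
def Pref {n : ℕ} {a : Fin n → Fin n → Bool} (μ : PathSpace a) :
    Set (FreeGroup (Fin n)) :=
  {x | ∃ k : ℕ, x = prefWord μ.1 k}

/-- `𝔽_n^+`, the positive words, as a subset of `𝔽_n`. -/
def FnPlus (n : ℕ) : Set (FreeGroup (Fin n)) :=
  {x | ∃ l : List (Fin n), x = wordToF l}

section Words

variable {n : ℕ}

theorem wordToF_eq_mk (l : List (Fin n)) :
    wordToF l = FreeGroup.mk (l.map fun i => (i, true)) := by
  induction l with
  | nil => rfl
  | cons i l ih =>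
    have : wordToF (i :: l) = FreeGroup.of i * wordToF l := by simp [wordToF]
    rw [this, ih]
    rfl

theorem wordToF_injective : Function.Injective (wordToF (n := n)) := by
  intro l l' h
  have red (l : List (Fin n)) : (wordToF l).toWord = l.map fun i => (i, true) := by
    rw [wordToF_eq_mk, FreeGroup.toWord_mk]
    apply FreeGroup.IsReduced.reduce_eq
    unfold FreeGroup.IsReduced
    rw [List.isChain_map]
    exact List.Pairwise.isChain (List.pairwise_of_forall fun _ _ _ => rfl)
  have h' := congrArg FreeGroup.toWord h
  rw [red, red] at h'
  exact (List.map_injective_iff.2 fun i j hij => (Prod.mk.inj hij).1) h'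

theorem wordToF_append (l l' : List (Fin n)) :
    wordToF (l ++ l') = wordToF l * wordToF l' := by
  simp [wordToF]

@[simp]
theorem prefWord_zero (μ : ℕ → Fin n) : prefWord μ 0 = 1 := by
  simp [prefWord, wordToF]

theorem prefWord_succ (μ : ℕ → Fin n) (k : ℕ) :
    prefWord μ (k + 1) = prefWord μ k * FreeGroup.of (μ k) := by
  simp [prefWord, wordToF, List.range_succ]

theorem prefWord_succ' (μ : ℕ → Fin n) (k : ℕ) :
    prefWord μ (k + 1) = FreeGroup.of (μ 0) * prefWord (fun i => μ (i + 1)) k := by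
  simp [prefWord, wordToF, List.range_succ_eq_map, Function.comp_def]

theorem prefWord_eq_prefWord {μ ν : ℕ → Fin n} {k m : ℕ} (h : prefWord μ k = prefWord ν m) :
    k = m ∧ ∀ i < k, μ i = ν i := by
  have h' := wordToF_injective h
  have hkm : k = m := by simpa using congrArg List.length h'
  subst hkm
  refine ⟨rfl, fun i hi => ?_⟩
  simpa using List.map_inj_left.1 h' i (List.mem_range.2 hi)

/-- The sequence `i ν_0 ν_1 ⋯`. -/
def seqCons (i : Fin n) (ν : ℕ → Fin n) : ℕ → Fin n
  | 0 => i
  | k + 1 => ν k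

/-- `TailRep μ x ν` says that `ν = x⁻¹ μ` for the partial action of the free group on
sequences by exchanging initial segments. -/
def TailRep (μ : ℕ → Fin n) (x : FreeGroup (Fin n)) (ν : ℕ → Fin n) : Prop :=
  ∃ k m, x = prefWord μ k * (prefWord ν m)⁻¹ ∧ ∀ i, μ (k + i) = ν (m + i)

namespace TailRep

variable {μ ν ν' : ℕ → Fin n} {x : FreeGroup (Fin n)}

theorem succ {k m : ℕ} (hx : x = prefWord μ k * (prefWord ν m)⁻¹)
    (h : ∀ i, μ (k + i) = ν (m + i)) :
    x = prefWord μ (k + 1) * (prefWord ν (m + 1))⁻¹ ∧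
      ∀ i, μ (k + 1 + i) = ν (m + 1 + i) := by
  constructor
  · have h0 : μ k = ν m := h 0
    rw [hx, prefWord_succ, prefWord_succ, h0]
    group
  · intro i
    rw [add_assoc, add_assoc]
    exact h (1 + i)

theorem add {k m : ℕ} (hx : x = prefWord μ k * (prefWord ν m)⁻¹)
    (h : ∀ i, μ (k + i) = ν (m + i)) (p : ℕ) :
    x = prefWord μ (k + p) * (prefWord ν (m + p))⁻¹ ∧
      ∀ i, μ (k + p + i) = ν (m + p + i) := by
  induction p with
  | zero => exact ⟨hx, h⟩
  | succ p ih => exact succ ih.1 ih.2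

theorem unique (h : TailRep μ x ν) (h' : TailRep μ x ν') : ν = ν' := by
  obtain ⟨k, m, hx, ht⟩ := h
  obtain ⟨k', m', hx', ht'⟩ := h'
  obtain ⟨h1, h2⟩ := add hx ht k'
  obtain ⟨h1', h2'⟩ := add hx' ht' k
  rw [add_comm k' k] at h1' h2'
  rw [h1] at h1'
  obtain ⟨hm, heq⟩ := prefWord_eq_prefWord (inv_injective (mul_left_cancel h1'))
  rw [← hm] at h2'
  funext i
  rcases lt_or_ge i (m + k') with hi | hi
  · exact heq i hi
  · obtain ⟨d, rfl⟩ := Nat.exists_eq_add_of_le hi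
    rw [← h2, ← h2']

theorem mul_of (h : TailRep μ x ν) :
    TailRep μ (x * FreeGroup.of (ν 0)) fun i => ν (i + 1) := by
  obtain ⟨k, m, hx, ht⟩ := h
  obtain ⟨h1, h2⟩ := succ hx ht
  refine ⟨k + 1, m, ?_, fun i => ?_⟩
  · rw [h1, prefWord_succ' ν]
    group
  · rw [h2 i, add_right_comm]

theorem mul_of_inv (h : TailRep μ x ν) (i : Fin n) :
    TailRep μ (x * (FreeGroup.of i)⁻¹) (seqCons i ν) := by
  obtain ⟨k, m, hx, ht⟩ := h
  refine ⟨k, m + 1, ?_, fun j => ?_⟩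
  · have : (fun j => seqCons i ν (j + 1)) = ν := rfl
    rw [prefWord_succ', this, hx, seqCons]
    group
  · rw [ht, add_right_comm]
    rfl

theorem eq_head {j : Fin n} (h : TailRep μ x ν) (h' : TailRep μ (x * FreeGroup.of j) ν') :
    j = ν 0 := by
  have h2 := h'.mul_of_inv j
  rw [mul_inv_cancel_right] at h2
  rw [h.unique h2]
  rfl

theorem prefWord_self (μ : ℕ → Fin n) (k : ℕ) :
    TailRep μ (prefWord μ k) fun i => μ (k + i) :=
  ⟨k, 0, by simp, fun i => by simp⟩

end TailRep

theorem exists_prefix_of_red {α : Type*} {L L' : List (α × Bool)} (h : FreeGroup.Red L L') :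
    ∀ P, P <+: L' → ∃ Q, Q <+: L ∧ FreeGroup.mk Q = FreeGroup.mk P := by
  induction h with
  | refl => exact fun P hP => ⟨P, hP, rfl⟩
  | tail _ hs ih =>
    intro P hP
    suffices ∃ Q, Q <+: _ ∧ FreeGroup.mk Q = FreeGroup.mk P by
      obtain ⟨Q, hQ, hQP⟩ := this
      obtain ⟨R, hR, hRQ⟩ := ih Q hQ
      exact ⟨R, hR, hRQ.trans hQP⟩
    obtain @⟨L₁, L₂, y, b⟩ := hs
    rcases List.prefix_or_prefix_of_prefix hP (List.prefix_append L₁ L₂) with hP1 | ⟨P', rfl⟩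
    · exact ⟨P, hP1.trans (List.prefix_append _ _), rfl⟩
    · refine ⟨L₁ ++ (y, b) :: (y, !b) :: P', ?_, Quot.sound FreeGroup.Red.Step.not⟩
      rw [List.prefix_append_right_inj] at hP ⊢
      simpa using hP

theorem toWord_mul_of_norm_add {α : Type*} [DecidableEq α] {t r : FreeGroup α}
    (h : (t * r).norm = t.norm + r.norm) : (t * r).toWord = t.toWord ++ r.toWord := by
  apply (FreeGroup.toWord_mul_sublist t r).eq_of_length
  simpa [FreeGroup.norm] using h

end Words

section TailSet

variable {n : ℕ} {a : Fin n → Fin n → Bool}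

/-- The subset of `𝔽_n` associated to `μ`: those `x` for which `x⁻¹ μ` is an
admissible path. -/
def tailSet (a : Fin n → Fin n → Bool) (μ : ℕ → Fin n) : Set (FreeGroup (Fin n)) :=
  {x | ∃ ν, TailRep μ x ν ∧ ∀ j, a (ν j) (ν (j + 1)) = true}

theorem prefWord_mem_tailSet (μ : PathSpace a) (k : ℕ) :
    prefWord μ.1 k ∈ tailSet a μ.1 :=
  ⟨_, TailRep.prefWord_self μ.1 k, fun j => μ.2 (k + j)⟩

theorem exists_word_of_mem_tailSet (μ : PathSpace a) {x : FreeGroup (Fin n)}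
    (hx : x ∈ tailSet a μ.1) :
    ∃ L, FreeGroup.mk L = x ∧ ∀ P, P <+: L → FreeGroup.mk P ∈ tailSet a μ.1 := by
  have step {x : FreeGroup (Fin n)} (p : Fin n × Bool)
      (h : ∃ L, FreeGroup.mk L = x ∧ ∀ P, P <+: L → FreeGroup.mk P ∈ tailSet a μ.1)
      (hp : x * FreeGroup.mk [p] ∈ tailSet a μ.1) :
      ∃ L, FreeGroup.mk L = x * FreeGroup.mk [p] ∧
        ∀ P, P <+: L → FreeGroup.mk P ∈ tailSet a μ.1 := by
    obtain ⟨L, rfl, hL⟩ := h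
    refine ⟨L ++ [p], FreeGroup.mul_mk.symm, fun P hP => ?_⟩
    rcases List.prefix_concat_iff.1 hP with rfl | hP
    · rwa [← FreeGroup.mul_mk]
    · exact hL P hP
  obtain ⟨ν, ⟨k, m, rfl, ht⟩, hν⟩ := hx
  induction m generalizing ν with
  | zero =>
    simp only [prefWord_zero, inv_one, mul_one]
    clear ht hν
    induction k with
    | zero =>
      refine ⟨[], by simp [FreeGroup.one_eq_mk], fun P hP => ?_⟩
      rw [List.prefix_nil.1 hP, ← FreeGroup.one_eq_mk, ← prefWord_zero μ.1]
      exact prefWord_mem_tailSet μ 0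
    | succ k ih =>
      have := prefWord_mem_tailSet μ (k + 1)
      rw [prefWord_succ] at this ⊢
      exact step (μ.1 k, true) ih this
  | succ m ih =>
    have hmem : prefWord μ.1 k * (prefWord ν (m + 1))⁻¹ ∈ tailSet a μ.1 :=
      ⟨ν, ⟨k, m + 1, rfl, ht⟩, hν⟩
    have heq : prefWord μ.1 k * (prefWord ν (m + 1))⁻¹ =
        prefWord μ.1 k * (prefWord (fun i => ν (i + 1)) m)⁻¹ * FreeGroup.mk [(ν 0, false)] := by
      have : FreeGroup.mk [(ν 0, false)] = (FreeGroup.of (ν 0))⁻¹ := rfl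
      rw [this, prefWord_succ']
      group
    rw [heq] at hmem ⊢
    exact step _ (ih (fun i => ν (i + 1)) (fun j => hν (j + 1))
      fun i => by rw [ht, add_right_comm]) hmem

theorem sCond_tailSet (μ : PathSpace a) : SCond a (tailSet a μ.1) := by
  refine ⟨?_, ?_, ?_, ?_⟩
  · simpa using prefWord_mem_tailSet μ 0
  · intro t r h hnorm
    obtain ⟨L, hL, hpre⟩ := exists_word_of_mem_tailSet μ h
    have hred : FreeGroup.Red L (t.toWord ++ r.toWord) := by
      rw [← toWord_mul_of_norm_add hnorm, ← hL, FreeGroup.toWord_mk]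
      exact FreeGroup.reduce.red
    obtain ⟨Q, hQ, hQt⟩ := exists_prefix_of_red hred _ (List.prefix_append _ _)
    rw [FreeGroup.mk_toWord] at hQt
    exact hQt ▸ hpre Q hQ
  · rintro t ⟨ν, hν, hp⟩
    refine ⟨ν 0, ⟨_, hν.mul_of, fun j => hp (j + 1)⟩, ?_⟩
    rintro j ⟨ν', hν', -⟩
    exact hν.eq_head hν'
  · rintro t ⟨ν, hν, hp⟩ i j ⟨ν', hν', -⟩
    rw [hν.eq_head hν']
    constructor
    · rintro ⟨ξ, hξ, hpξ⟩
      rw [hξ.unique (hν.mul_of_inv i)] at hpξ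
      exact hpξ 0
    · intro hi
      refine ⟨_, hν.mul_of_inv i, fun k => ?_⟩
      cases k with
      | zero => exact hi
      | succ k => exact hp k

theorem tailSet_inter_FnPlus (μ : PathSpace a) : tailSet a μ.1 ∩ FnPlus n = Pref μ := by
  apply Set.Subset.antisymm
  · rintro _ ⟨⟨ν, ⟨k, m, hx, -⟩, -⟩, l, rfl⟩
    rw [eq_mul_inv_iff_mul_eq, prefWord, prefWord, ← wordToF_append] at hx
    have hl : l <+: (List.range k).map μ.1 := ⟨_, wordToF_injective hx⟩
    refine ⟨l.length, ?_⟩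
    rw [List.prefix_iff_eq_take, ← List.map_take, List.take_range] at hl
    have hlen : l.length = min l.length k := by simpa using congrArg List.length hl
    rw [← hlen] at hl
    rw [prefWord, ← hl]
  · rintro _ ⟨k, rfl⟩
    exact ⟨prefWord_mem_tailSet μ k, _, rfl⟩

theorem pref_injective : Function.Injective (Pref (a := a)) := by
  intro μ μ' h
  apply Subtype.ext
  funext i
  have hi : prefWord μ.1 (i + 1) ∈ Pref μ' := h ▸ ⟨i + 1, rfl⟩
  obtain ⟨k, hk⟩ := hi
  exact (prefWord_eq_prefWord hk).2 i i.lt_succ_self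

theorem tailSet_subset {ω : Set (FreeGroup (Fin n))} (hω : SCond a ω) {μ : ℕ → Fin n}
    (hμ : ∀ k, prefWord μ k ∈ ω) : tailSet a μ ⊆ ω := by
  rintro _ ⟨ν, ⟨k, m, rfl, ht⟩, hν⟩
  induction m generalizing k ν with
  | zero => simpa using hμ k
  | succ m ih =>
    have ht' (i : ℕ) : μ (k + i) = ν (m + i + 1) := by rw [ht, add_right_comm]
    have hx := ih (fun i => ν (i + 1)) (fun j => hν (j + 1)) k ht'
    have hy := ih (fun i => ν (i + 1 + 1)) (fun j => hν (j + 1 + 1)) (k + 1)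
      fun i => by rw [add_assoc, ht']; congr 1; ring
    have hxy : prefWord μ k * (prefWord (fun i => ν (i + 1)) m)⁻¹ * FreeGroup.of (ν 1) ∈ ω := by
      convert hy using 1
      rw [(TailRep.succ rfl ht').1, prefWord_succ' _ m]
      group
    have := (hω.2.2.2 _ hx (ν 0) (ν 1) hxy).2 (hν 0)
    convert this using 1
    rw [prefWord_succ']
    group

theorem SCond.eq_of_subset {ω ω' : Set (FreeGroup (Fin n))} (hω : SCond a ω) (hω' : SCond a ω')
    (h : ω' ⊆ ω) : ω' = ω := by
  refine h.antisymm ?_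
  suffices ∀ L : List (Fin n × Bool), FreeGroup.IsReduced L → FreeGroup.mk L ∈ ω →
      FreeGroup.mk L ∈ ω' by
    intro x hx
    rw [← FreeGroup.mk_toWord (x := x)] at hx ⊢
    exact this _ FreeGroup.isReduced_toWord hx
  intro L
  induction L using List.reverseRecOn with
  | nil => exact fun _ _ => hω'.1
  | append_singleton L p ih =>
    intro hred hmem
    have hredL : FreeGroup.IsReduced L := hred.infix (List.prefix_append L [p]).isInfix
    have hredp : FreeGroup.IsReduced [p] := hred.infix (List.suffix_append L [p]).isInfix
    rw [← FreeGroup.mul_mk] at hmem ⊢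
    have hLω : FreeGroup.mk L ∈ ω := by
      refine hω.2.1 _ _ hmem ?_
      rw [FreeGroup.mul_mk]
      simp only [FreeGroup.norm, FreeGroup.toWord_mk]
      rw [hred.reduce_eq, hredL.reduce_eq, hredp.reduce_eq]
      simp
    have hL := ih hredL hLω
    obtain ⟨j, hj, -⟩ := hω'.2.2.1 _ hL
    obtain ⟨i, b⟩ := p
    cases b with
    | true =>
      have : i = j := (hω.2.2.1 _ hLω).unique hmem (h hj)
      rw [this]
      exact hj
    | false =>
      have := (hω.2.2.2 _ hLω i j (h hj)).1 hmem
      exact (hω'.2.2.2 _ hL i j hj).2 this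

theorem exists_eq_tailSet {ω : Set (FreeGroup (Fin n))} (hω : SCond a ω) :
    ∃ μ : PathSpace a, tailSet a μ.1 = ω := by
  have : Nonempty (Fin n) := (hω.2.2.1 1 hω.1).exists.nonempty
  choose! f hf using fun t ht => (hω.2.2.1 t ht).exists
  let s : ℕ → FreeGroup (Fin n) := Nat.rec 1 fun _ t => t * FreeGroup.of (f t)
  have hs (k : ℕ) : s (k + 1) = s k * FreeGroup.of (f (s k)) := rfl
  have hsω (k : ℕ) : s k ∈ ω := by
    induction k with
    | zero => exact hω.1
    | succ k ih => exact hf _ ih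
  have hpref (k : ℕ) : prefWord (fun k => f (s k)) k = s k := by
    induction k with
    | zero => simp [s]
    | succ k ih => rw [prefWord_succ, ih, hs]
  refine ⟨⟨fun k => f (s k), fun k => ?_⟩, ?_⟩
  · refine (hω.2.2.2 _ (hsω (k + 1)) (f (s k)) _ (hf _ (hsω (k + 1)))).1 ?_
    rw [hs, mul_inv_cancel_right]
    exact hsω k
  · refine hω.eq_of_subset (sCond_tailSet _) (tailSet_subset hω fun k => ?_)
    rw [hpref]
    exact hsω k

theorem isClosed_setOf_comp_of_discrete {X Y : Type*} [TopologicalSpace X] [TopologicalSpace Y]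
    [DiscreteTopology Y] {f : X → Y} (hf : Continuous f) (P : Y → Prop) :
    IsClosed {x | P (f x)} :=
  (isClosed_discrete {y | P y}).preimage hf

theorem isClosed_setOf_sCond :
    IsClosed {ω : FreeGroup (Fin n) → Bool | SCond a {x | ω x = true}} := by
  simp only [SCond, Set.mem_ofPred_eq, Set.ofPred_and, Set.ofPred_forall]
  refine IsClosed.inter ?_ (IsClosed.inter ?_ (IsClosed.inter ?_ ?_))
  · have hf : Continuous fun ω : FreeGroup (Fin n) → Bool => ω 1 := by fun_prop
    exact isClosed_setOf_comp_of_discrete hf fun b => b = true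
  · refine isClosed_iInter fun t => isClosed_iInter fun r => ?_
    have hf : Continuous fun ω : FreeGroup (Fin n) → Bool => (ω (t * r), ω t) := by fun_prop
    exact isClosed_setOf_comp_of_discrete hf fun b =>
      b.1 = true → (t * r).norm = t.norm + r.norm → b.2 = true
  · refine isClosed_iInter fun t => ?_
    have hf : Continuous fun ω : FreeGroup (Fin n) → Bool =>
      (ω t, fun j => ω (t * FreeGroup.of j)) := by fun_prop
    exact isClosed_setOf_comp_of_discrete hf fun b => b.1 = true → ∃! j, b.2 j = true
  · refine isClosed_iInter fun t => ?_
    have hf : Continuous fun ω : FreeGroup (Fin n) → Bool =>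
      (ω t, (fun j => ω (t * FreeGroup.of j)), fun i => ω (t * (FreeGroup.of i)⁻¹)) := by
      fun_prop
    exact isClosed_setOf_comp_of_discrete hf fun b =>
      b.1 = true → ∀ i j, b.2.1 j = true → (b.2.2 i = true ↔ a i j = true)

theorem apply_eq_iff_exists_mem_tailSet (μ : PathSpace a) (k : ℕ) (j : Fin n) :
    μ.1 k = j ↔ ∃ l : List (Fin n), l.length = k ∧ wordToF (l ++ [j]) ∈ tailSet a μ.1 := by
  constructor
  · rintro rfl
    refine ⟨(List.range k).map μ.1, by simp, ?_⟩
    have := prefWord_mem_tailSet μ (k + 1)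
    rwa [prefWord, List.range_succ, List.map_append] at this
  · rintro ⟨l, rfl, hl⟩
    have hmem : wordToF (l ++ [j]) ∈ Pref μ := tailSet_inter_FnPlus μ ▸ ⟨hl, _, rfl⟩
    obtain ⟨m, hm⟩ := hmem
    have hm' := wordToF_injective hm
    obtain rfl : l.length + 1 = m := by simpa using congrArg List.length hm'
    rw [List.range_succ, List.map_append] at hm'
    simpa using (List.append_inj_right' hm' rfl).symm

theorem continuous_of_setOf_eq_tailSet {f : OmegaCK a → PathSpace a}
    (hf : ∀ ω, tailSet a (f ω).1 = {x | ω.1 x = true}) : Continuous f := by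
  refine Continuous.subtype_mk (continuous_pi fun k => ?_) fun ω => (f ω).2
  refine continuous_discrete_rng.2 fun j => ?_
  have : (fun ω => (f ω).1 k) ⁻¹' {j} =
      ⋃ l ∈ {l : List (Fin n) | l.length = k}, {ω | ω.1 (wordToF (l ++ [j])) = true} := by
    ext ω
    simp [apply_eq_iff_exists_mem_tailSet, hf]
  rw [this]
  refine isOpen_biUnion fun l _ => ?_
  have hc : Continuous fun ω : OmegaCK a => ω.1 (wordToF (l ++ [j])) :=
    (continuous_apply (wordToF (l ++ [j]))).comp continuous_subtype_val
  exact (isOpen_discrete {b | b = true}).preimage hc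

theorem exists_homeomorph_tailSet (a : Fin n → Fin n → Bool) :
    ∃ φ : OmegaCK a ≃ₜ PathSpace a, ∀ ω, tailSet a (φ ω).1 = {x | ω.1 x = true} := by
  choose f hf using fun ω : OmegaCK a => exists_eq_tailSet ω.2
  have hbij : Function.Bijective f := by
    constructor
    · intro ω ω' h
      have h' : {x | ω.1 x = true} = {x | ω'.1 x = true} := by rw [← hf, ← hf, h]
      ext x
      rw [Bool.eq_iff_iff]
      exact Set.ext_iff.1 h' x
    · intro μ
      classical
      have hμ : {x | decide (x ∈ tailSet a μ.1) = true} = tailSet a μ.1 := by simp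
      refine ⟨⟨fun x => decide (x ∈ tailSet a μ.1), by simpa using sCond_tailSet μ⟩, pref_injective ?_⟩
      rw [← tailSet_inter_FnPlus, ← tailSet_inter_FnPlus, hf, hμ]
  have : CompactSpace (OmegaCK a) := isCompact_iff_compactSpace.1 isClosed_setOf_sCond.isCompact
  have hcont : Continuous (Equiv.ofBijective f hbij) := continuous_of_setOf_eq_tailSet hf
  exact ⟨hcont.homeoOfEquivCompactToT2, hf⟩

end TailSet

/-- the map `ω ↦ ω ∩ 𝔽_n^+` is a bijection from `Ω_CK` onto
`{Pref μ : μ ∈ P_A^∞}`, and the induced map `Ω_CK → P_A^∞` (sending `ω` to the unique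
`μ` with `ω ∩ 𝔽_n^+ = Pref μ`) is a homeomorphism. -/
theorem stmt_13 (n : ℕ) (hn : 1 ≤ n) (a : Fin n → Fin n → Bool)
    (hA : ∀ i, ∃ j, a i j = true) :
    Set.BijOn
      (fun ω : FreeGroup (Fin n) → Bool => {x | ω x = true} ∩ FnPlus n)
      {ω : FreeGroup (Fin n) → Bool | SCond a {x | ω x = true}}
      {S : Set (FreeGroup (Fin n)) | ∃ μ : PathSpace a, S = Pref μ} ∧
    ∃ φ : OmegaCK a ≃ₜ PathSpace a,
      ∀ ω : OmegaCK a, {x | ω.1 x = true} ∩ FnPlus n = Pref (φ ω) := by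
  obtain ⟨φ, hφ⟩ := exists_homeomorph_tailSet a
  have hPref (ω : OmegaCK a) : {x | ω.1 x = true} ∩ FnPlus n = Pref (φ ω) := by
    rw [← hφ, tailSet_inter_FnPlus]
  refine ⟨⟨fun ω hω => ⟨φ ⟨ω, hω⟩, hPref ⟨ω, hω⟩⟩, fun ω hω ω' hω' h => ?_, ?_⟩, φ, hPref⟩
  · have h' : Pref (φ ⟨ω, hω⟩) = Pref (φ ⟨ω', hω'⟩) := by
      rw [← hPref, ← hPref]
      exact h
    exact congrArg Subtype.val (φ.injective (pref_injective h'))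
  · rintro _ ⟨μ, rfl⟩
    refine ⟨(φ.symm μ).1, (φ.symm μ).2, ?_⟩
    simpa using hPref (φ.symm μ)
end

section
/- The following are equivalent: (a) A has no terminal circuits; (b) P_A^∞ has no isolated points; (c) the set of aperiodic paths is dense in P_A^∞. -/
/-- A word is admissible for the matrix `a` if consecutive letters `i, j` satisfy
`a i j = 1`; the empty word and single letters are admissible. -/
def AdmissibleWord {n : ℕ} (a : Fin n → Fin n → Bool) (l : List (Fin n)) : Prop :=
  l.Chain' (fun i j => a i j = true)

/-- `γ` is a circuit: a nonempty admissible word such that `γγ` is admissible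
(i.e. `a (last γ) (head γ) = 1`). -/
def IsCircuit {n : ℕ} (a : Fin n → Fin n → Bool) (γ : List (Fin n)) : Prop :=
  γ ≠ [] ∧ AdmissibleWord a (γ ++ γ)

/-- A circuit is terminal if each of its letters indexes a row of `a` having exactly
one nonzero entry. -/
def IsTerminal {n : ℕ} (a : Fin n → Fin n → Bool) (γ : List (Fin n)) : Prop :=
  ∀ i ∈ γ, ∃! j : Fin n, a i j = true

/-- `μ = xγγγ⋯`: the sequence `μ` starts with the word `x`, followed by `γ`, and is
periodic of period `|γ|` from position `|x|` on. -/
def EqWordThenCycle {n : ℕ} (μ : ℕ → Fin n) (x γ : List (Fin n)) : Prop :=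
  (∀ j : ℕ, ∀ h : j < x.length, μ j = x.get ⟨j, h⟩) ∧
  (∀ j : ℕ, ∀ h : j < γ.length, μ (x.length + j) = γ.get ⟨j, h⟩) ∧
  (∀ j : ℕ, μ (x.length + γ.length + j) = μ (x.length + j))

/-- A path is periodic if `μ = xγγγ⋯` for some admissible `x` and nonempty admissible
circuit `γ` with `xγ` admissible; aperiodic otherwise. -/
def IsAperiodic {n : ℕ} (a : Fin n → Fin n → Bool) (μ : ℕ → Fin n) : Prop :=
  ¬ ∃ x γ : List (Fin n),
      AdmissibleWord a (x ++ γ) ∧ IsCircuit a γ ∧ EqWordThenCycle μ x γ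

theorem admissibleWord_map_range' {n : ℕ} {a : Fin n → Fin n → Bool} {μ : ℕ → Fin n}
    (hμ : ∀ j, a (μ j) (μ (j + 1)) = true) (s k : ℕ) :
    AdmissibleWord a ((List.range' s k).map μ) := by
  change List.IsChain _ _
  rw [List.isChain_iff_getElem]
  intro i hi
  simpa [add_assoc] using hμ (s + i)

theorem map_range'_add_period {n : ℕ} {μ : ℕ → Fin n} {p q : ℕ}
    (hper : ∀ j, μ (p + q + j) = μ (p + j)) :
    (List.range' (p + q) q).map μ = (List.range' p q).map μ := by
  apply List.ext_getElem
  · simp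
  · intro i h₁ h₂
    simpa using hper i

theorem isCircuit_map_range' {n : ℕ} {a : Fin n → Fin n → Bool} {μ : ℕ → Fin n}
    (hμ : ∀ j, a (μ j) (μ (j + 1)) = true) {p q : ℕ} (hq : 0 < q)
    (hper : ∀ j, μ (p + q + j) = μ (p + j)) :
    IsCircuit a ((List.range' p q).map μ) := by
  refine ⟨by simp [hq.ne'], ?_⟩
  have h := admissibleWord_map_range' hμ p (q + q)
  rwa [← List.range'_append_1, List.map_append, map_range'_add_period hper] at h

theorem not_isAperiodic_of_eventually_periodic {n : ℕ} {a : Fin n → Fin n → Bool} {μ : ℕ → Fin n}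
    (hμ : ∀ j, a (μ j) (μ (j + 1)) = true) {p q : ℕ} (hq : 0 < q)
    (hper : ∀ j, μ (p + q + j) = μ (p + j)) : ¬ IsAperiodic a μ := by
  intro h
  refine h ⟨(List.range' 0 p).map μ, (List.range' p q).map μ, ?_,
    isCircuit_map_range' hμ hq hper, ?_, ?_, ?_⟩
  · have h := admissibleWord_map_range' hμ 0 (p + q)
    rwa [← List.range'_append_1, List.map_append, zero_add] at h
  · intro j hj
    simp
  · intro j hj
    simp
  · intro j
    simpa using hper j

/-- Every path can be modified after position `m` to continue with any letter allowed there. -/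
theorem exists_path_extension {n : ℕ} {a : Fin n → Fin n → Bool} (hA : ∀ i, ∃ j, a i j = true)
    (μ : PathSpace a) (m : ℕ) {j : Fin n} (hj : a (μ.1 m) j = true) :
    ∃ ν : PathSpace a, (∀ k ≤ m, ν.1 k = μ.1 k) ∧ ν.1 (m + 1) = j := by
  choose f hf using hA
  refine ⟨⟨fun k => if k ≤ m then μ.1 k else f^[k - (m + 1)] j, ?_⟩, ?_, ?_⟩
  · intro k
    rcases lt_trichotomy k m with h | rfl | h
    · simpa [h.le, Nat.succ_le_of_lt h] using μ.2 k
    · simpa using hj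
    · have h₁ : ¬ k ≤ m := by omega
      have h₂ : ¬ k + 1 ≤ m := by omega
      have h₃ : k + 1 - (m + 1) = (k - (m + 1)) + 1 := by omega
      simp only [h₁, h₂, if_false, h₃, Function.iterate_succ_apply']
      exact hf _
  · intro k hk
    simp [hk]
  · simp

/-- An isolated point is determined by a finite initial segment. -/
theorem exists_prefix_of_isOpen_singleton {n : ℕ} {a : Fin n → Fin n → Bool} {μ : PathSpace a}
    (hμ : IsOpen ({μ} : Set (PathSpace a))) :
    ∃ N, ∀ ν : PathSpace a, (∀ k ≤ N, ν.1 k = μ.1 k) → ν = μ := by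
  obtain ⟨U, hU, hUμ⟩ := isOpen_induced_iff.1 hμ
  have hmem : μ.1 ∈ U := by
    have : μ ∈ Subtype.val ⁻¹' U := by rw [hUμ]; rfl
    exact this
  obtain ⟨I, u, hu, hIU⟩ := isOpen_pi_iff.1 hU μ.1 hmem
  refine ⟨I.sup id, fun ν hν => ?_⟩
  have : ν ∈ Subtype.val ⁻¹' U := by
    apply hIU
    intro i hi
    rw [hν i (Finset.le_sup (f := id) hi)]
    exact (hu i hi).2
  rwa [hUμ] at this

/-- An isolated path eventually runs around a terminal circuit. -/
theorem exists_period_of_isOpen_singleton {n : ℕ} {a : Fin n → Fin n → Bool}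
    (hA : ∀ i, ∃ j, a i j = true) {μ : PathSpace a} (hμ : IsOpen ({μ} : Set (PathSpace a))) :
    ∃ p q, 0 < q ∧ (∀ j, μ.1 (p + q + j) = μ.1 (p + j)) ∧
      IsTerminal a ((List.range' p q).map μ.1) := by
  obtain ⟨N, hN⟩ := exists_prefix_of_isOpen_singleton hμ
  have huniq : ∀ m, N ≤ m → ∀ j, a (μ.1 m) j = true → j = μ.1 (m + 1) := by
    intro m hm j hj
    obtain ⟨ν, hν, rfl⟩ := exists_path_extension hA μ m hj
    rw [hN ν fun k hk => hν k (hk.trans hm)]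
  obtain ⟨s, t, hst, heq⟩ : ∃ s t, s < t ∧ μ.1 (N + s) = μ.1 (N + t) := by
    obtain ⟨s, t, hne, h⟩ := Finite.exists_ne_map_eq_of_infinite fun k => μ.1 (N + k)
    rcases hne.lt_or_gt with h' | h'
    · exact ⟨s, t, h', h⟩
    · exact ⟨t, s, h', h.symm⟩
  refine ⟨N + s, t - s, by omega, fun j => ?_, fun i hi => ?_⟩
  · have hNt : N + s + (t - s) = N + t := by omega
    rw [hNt]
    induction j with
    | zero => exact heq.symm
    | succ j ih =>
      refine huniq (N + s + j) (by omega) _ ?_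
      rw [← ih]
      exact μ.2 _
  · obtain ⟨m, hm, rfl⟩ := List.mem_map.1 hi
    rw [List.mem_range'_1] at hm
    exact ⟨μ.1 (m + 1), μ.2 m, huniq m (by omega)⟩

theorem exists_isOpen_singleton_of_isTerminal {n : ℕ} {a : Fin n → Fin n → Bool}
    {γ : List (Fin n)} (hγ : IsCircuit a γ) (hterm : IsTerminal a γ) :
    ∃ μ : PathSpace a, IsOpen ({μ} : Set (PathSpace a)) := by
  have hL : 0 < γ.length := List.length_pos_iff.2 hγ.1
  have hchain : List.IsChain (fun i j => a i j = true) (γ ++ γ) := hγ.2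
  rw [List.isChain_iff_getElem] at hchain
  let μ : PathSpace a := ⟨fun k => γ[k % γ.length]'(Nat.mod_lt _ hL), fun k => by
    have hk := Nat.mod_lt k hL
    have h := hchain (k % γ.length) (by simp; omega)
    rw [List.getElem_append_left hk] at h
    rcases Nat.lt_or_ge (k % γ.length + 1) γ.length with h' | h'
    · rw [List.getElem_append_left h'] at h
      have : (k + 1) % γ.length = k % γ.length + 1 := by
        rw [← Nat.mod_add_mod, Nat.mod_eq_of_lt h']
      simpa only [this] using h
    · rw [List.getElem_append_right h'] at h
      have h₁ : k % γ.length + 1 = γ.length := by omega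
      have : (k + 1) % γ.length = k % γ.length + 1 - γ.length := by
        rw [← Nat.mod_add_mod, h₁]; simp
      simpa only [this] using h⟩
  have hcont : Continuous fun ν : PathSpace a => ν.1 0 :=
    (continuous_apply 0).comp continuous_subtype_val
  refine ⟨μ, ?_⟩
  convert (isOpen_discrete {μ.1 0}).preimage hcont using 1
  ext ν
  refine ⟨fun h => by rw [Set.mem_singleton_iff.1 h]; rfl, fun h => ?_⟩
  refine Subtype.ext (funext fun k => ?_)
  induction k with
  | zero => exact h
  | succ k ih =>
    refine (hterm (μ.1 k) (List.getElem_mem _)).unique ?_ (μ.2 k)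
    rw [← ih]
    exact ν.2 k

theorem EqWordThenCycle.unique {n : ℕ} {μ ν : ℕ → Fin n} {x γ : List (Fin n)} (hγ : γ ≠ [])
    (hμ : EqWordThenCycle μ x γ) (hν : EqWordThenCycle ν x γ) : μ = ν := by
  have hL : 0 < γ.length := List.length_pos_iff.2 hγ
  funext k
  induction k using Nat.strong_induction_on with
  | _ k ih =>
    rcases Nat.lt_or_ge k x.length with h | h
    · rw [hμ.1 k h, hν.1 k h]
    obtain ⟨j, rfl⟩ := Nat.exists_eq_add_of_le h
    rcases Nat.lt_or_ge j γ.length with h' | h'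
    · rw [hμ.2.1 j h', hν.2.1 j h']
    obtain ⟨i, rfl⟩ := Nat.exists_eq_add_of_le h'
    rw [← add_assoc, hμ.2.2, hν.2.2]
    exact ih _ (by omega)

theorem countable_setOf_not_isAperiodic {n : ℕ} (a : Fin n → Fin n → Bool) :
    {μ : PathSpace a | ¬ IsAperiodic a μ.1}.Countable := by
  have hsub : {μ : PathSpace a | ¬ IsAperiodic a μ.1} ⊆
      ⋃ w : List (Fin n) × List (Fin n),
        {μ : PathSpace a | w.2 ≠ [] ∧ EqWordThenCycle μ.1 w.1 w.2} := by
    intro μ hμ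
    obtain ⟨x, γ, -, hγ, h⟩ := not_not.1 hμ
    exact Set.mem_iUnion.2 ⟨(x, γ), hγ.1, h⟩
  refine (Set.countable_iUnion fun w => Set.Subsingleton.countable ?_).mono hsub
  rintro μ ⟨hw, hμ⟩ ν ⟨-, hν⟩
  exact Subtype.ext (hμ.unique hw hν)

theorem compactSpace_pathSpace {n : ℕ} (a : Fin n → Fin n → Bool) :
    CompactSpace (PathSpace a) := by
  refine isCompact_iff_compactSpace.1 (IsClosed.isCompact ?_)
  change IsClosed {μ : ℕ → Fin n | ∀ j, a (μ j) (μ (j + 1)) = true}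
  rw [Set.ofPred_forall]
  refine isClosed_iInter fun j => ?_
  have hcont : Continuous fun μ : ℕ → Fin n => (μ j, μ (j + 1)) := by fun_prop
  have ha : Continuous fun p : Fin n × Fin n => a p.1 p.2 := continuous_of_discreteTopology
  exact isClosed_eq (ha.comp hcont) continuous_const

theorem Set.Countable.dense_compl_of_forall_not_isOpen_singleton {X : Type*} [TopologicalSpace X]
    [T1Space X] [BaireSpace X] (hX : ∀ x : X, ¬ IsOpen ({x} : Set X)) {s : Set X}
    (hs : s.Countable) : Dense sᶜ := by
  have h := dense_biInter_of_isOpen (f := fun x : X => ({x}ᶜ : Set X))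
    (fun x _ => isOpen_compl_singleton) hs
    (fun x _ => dense_compl_singleton_iff_not_open.2 (hX x))
  refine h.mono fun y hy hys => ?_
  exact Set.mem_iInter₂.1 hy y hys rfl

/-- the following are equivalent: (a) `A` has no terminal circuits;
(b) `P_A^∞` has no isolated points; (c) the aperiodic paths are dense in `P_A^∞`. -/
theorem stmt_17 (n : ℕ) (hn : 1 ≤ n) (a : Fin n → Fin n → Bool)
    (hA : ∀ i, ∃ j, a i j = true) :
    ((¬ ∃ γ : List (Fin n), IsCircuit a γ ∧ IsTerminal a γ) ↔
      ∀ μ : PathSpace a, ¬ IsOpen ({μ} : Set (PathSpace a))) ∧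
    ((∀ μ : PathSpace a, ¬ IsOpen ({μ} : Set (PathSpace a))) ↔
      Dense {μ : PathSpace a | IsAperiodic a μ.1}) := by
  refine ⟨⟨fun h μ hμ => ?_, fun h ⟨γ, hγ, hterm⟩ => ?_⟩, fun h => ?_, fun h μ hμ => ?_⟩
  · obtain ⟨p, q, hq, hper, hterm⟩ := exists_period_of_isOpen_singleton hA hμ
    exact h ⟨_, isCircuit_map_range' μ.2 hq hper, hterm⟩
  · obtain ⟨μ, hμ⟩ := exists_isOpen_singleton_of_isTerminal hγ hterm
    exact h μ hμ
  · have := compactSpace_pathSpace a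
    simpa [Set.compl_ofPred] using
      (countable_setOf_not_isAperiodic a).dense_compl_of_forall_not_isOpen_singleton h
  · obtain ⟨p, q, hq, hper, -⟩ := exists_period_of_isOpen_singleton hA hμ
    obtain ⟨ν, rfl, hν⟩ := h.inter_open_nonempty _ hμ ⟨μ, rfl⟩
    exact not_isAperiodic_of_eventually_periodic ν.2 hq hper hν
end
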